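/- Let A be a simple unital C*-algebra with a unique tracial state τ, let n ∈ ℕ, and let p be a nonzero projection in M_n(A). Then the set 𝓕_p(A) = { (τ⊗Tr)(q)/(τ⊗Tr)(p) : k ∈ ℕ, q a nonzero projection in M_k(A) such that qM_k(A)q is *-isomorphic to pM_n(A)p } is a subgroup of the multiplicative group of positive real numbers: every element is strictly positive, 1 ∈ 𝓕_p(A), and 𝓕_p(A) is closed under multiplication and under taking inverses. -/

import Mathlib

open scoped ComplexOrder

/-- A *tracial state* on a unital C*-algebra `A` is a positive linear functional `τ` with
`τ(1) = 1` satisfying `τ(ab) = τ(ba)` for all `a b ∈ A`. -/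
def IsTracialState {A : Type*} [CStarAlgebra A] (τ : A →L[ℂ] ℂ) : Prop :=
  (∀ a : A, 0 ≤ τ (star a * a)) ∧ τ 1 = 1 ∧ ∀ a b : A, τ (a * b) = τ (b * a)

/-- The corner `p·M_n(A)·p` of the matrix algebra `M_n(A)` determined by a projection `p`
(`p * p = p`, `star p = p`), described as `{x | p * x = x ∧ x * p = x}` and bundled as a
non-unital star subalgebra of `M_n(A)`. -/
def corner {A : Type*} [CStarAlgebra A] {n : ℕ} (p : Matrix (Fin n) (Fin n) A)
    (hp : p * p = p) (hps : star p = p) :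
    NonUnitalStarSubalgebra ℂ (Matrix (Fin n) (Fin n) A) where
  carrier := {x | p * x = x ∧ x * p = x}
  add_mem' := fun hx hy => ⟨by rw [mul_add, hx.1, hy.1], by rw [add_mul, hx.2, hy.2]⟩
  zero_mem' := ⟨mul_zero p, zero_mul p⟩
  mul_mem' := fun {x y} hx hy => ⟨by rw [← mul_assoc, hx.1], by rw [mul_assoc, hy.2]⟩
  smul_mem' := fun c x hx => ⟨by rw [mul_smul_comm, hx.1], by rw [smul_mul_assoc, hx.2]⟩
  star_mem' := fun {x} hx =>
    ⟨by rw [← hps, ← star_mul, hx.2], by rw [← hps, ← star_mul, hx.1]⟩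


/-- The relative fundamental group `𝓕_p(A)`: the set of ratios `(τ⊗Tr)(q)/(τ⊗Tr)(p)` where `q`
ranges over the nonzero projections in some matrix algebra `M_k(A)` whose corner `q·M_k(A)·q`
is *-isomorphic to the corner `p·M_n(A)·p`. -/
noncomputable def relFundGroup {A : Type*} [CStarAlgebra A] (τ : A →L[ℂ] ℂ) {n : ℕ}
    (p : Matrix (Fin n) (Fin n) A) (hp : p * p = p) (hps : star p = p) : Set ℝ :=
  {t : ℝ | ∃ (k : ℕ) (q : Matrix (Fin k) (Fin k) A) (hq : q * q = q) (hqs : star q = q),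
    q ≠ 0 ∧ Nonempty ((corner q hq hqs) ≃⋆ₐ[ℂ] (corner p hp hps)) ∧
    t = (∑ i, τ (q i i)).re / (∑ i, τ (p i i)).re}

section Corners

open scoped Matrix

variable {A : Type*} [CStarAlgebra A]

/-- In a simple unital C*-algebra, the algebraic two-sided ideal generated by a nonzero element
contains the unit. -/
theorem one_mem_span_of_ne_zero [Nontrivial A]
    (hsimple : ∀ I : TwoSidedIdeal A, IsClosed (I : Set A) → I = ⊥ ∨ I = ⊤) {h : A} (hh : h ≠ 0) :
    (1 : A) ∈ TwoSidedIdeal.span {h} := by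
  set S : TwoSidedIdeal A := TwoSidedIdeal.span {h} with hS
  let I : TwoSidedIdeal A := TwoSidedIdeal.mk' (closure (S : Set A))
    (subset_closure S.zero_mem)
    (fun hx hy => map_mem_closure₂ continuous_add hx hy fun _ ha _ hb => S.add_mem ha hb)
    (fun hx => map_mem_closure continuous_neg hx fun _ ha => S.neg_mem ha)
    (fun {x _} hy => map_mem_closure (continuous_const_mul x) hy
      fun b hb => S.mul_mem_left x b hb)
    (fun {_} {y} hx => map_mem_closure (f := fun x => x * y) (continuous_mul_const y) hx
      fun a ha => S.mul_mem_right a y ha)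
  have hI : (I : Set A) = closure (S : Set A) := TwoSidedIdeal.coe_mk' _ _ _ _ _ _
  have hhS : h ∈ S := TwoSidedIdeal.subset_span rfl
  have h1 : (1 : A) ∈ closure (S : Set A) := by
    rcases hsimple I (hI ▸ isClosed_closure) with h0 | h0
    · have : h ∈ (I : Set A) := hI ▸ subset_closure hhS
      rw [h0] at this
      exact absurd (by simpa using this) hh
    · rw [← hI, h0]; simp
  obtain ⟨s, hs, hd⟩ := Metric.mem_closure_iff.1 h1 1 one_pos
  obtain ⟨u, hu⟩ : IsUnit s := by
    have := isUnit_one_sub_of_norm_lt_one (x := 1 - s) (by rwa [← dist_eq_norm])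
    simpa using this
  have := S.mul_mem_left (↑u⁻¹) s hs
  rwa [← hu, Units.inv_mul] at this

/-- In a simple unital C*-algebra every nonzero positive element is full, in the sense that
finitely many of its conjugates sum to the unit. -/
theorem exists_sum_conjugate_eq_one [Nontrivial A] [PartialOrder A] [StarOrderedRing A]
    (hsimple : ∀ I : TwoSidedIdeal A, IsClosed (I : Set A) → I = ⊥ ∨ I = ⊤) {h : A}
    (hpos : 0 ≤ h) (hh : h ≠ 0) :
    ∃ (ι : Type) (_ : Fintype ι) (z : ι → A), ∑ i, z i * h * star (z i) = 1 := by
  have hsa : star h = h := IsSelfAdjoint.of_nonneg hpos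
  have key : ∀ s ∈ TwoSidedIdeal.span {h}, ∃ (ι : Type) (_ : Fintype ι) (z : ι → A),
      s + star s ≤ ∑ i, z i * h * star (z i) ∧ -(s + star s) ≤ ∑ i, z i * h * star (z i) := by
    intro s hs
    rw [TwoSidedIdeal.mem_span_iff_mem_addSubgroup_closure] at hs
    induction hs using AddSubgroup.closure_induction with
    | mem x hx =>
      obtain ⟨_, ⟨a, -, _, rfl, rfl⟩, b, -, rfl⟩ := hx
      refine ⟨Bool, inferInstance, fun i => bif i then a else star b, ?_, ?_⟩
      · rw [← sub_nonneg]
        convert star_right_conjugate_nonneg hpos (a - star b) using 1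
        simp [hsa]
        noncomm_ring
      · rw [← sub_nonneg]
        convert star_right_conjugate_nonneg hpos (a + star b) using 1
        simp [hsa]
        noncomm_ring
    | zero => exact ⟨Empty, inferInstance, Empty.elim, by simp, by simp⟩
    | add x y _ _ hx hy =>
      obtain ⟨ι, _, z, h1, h2⟩ := hx
      obtain ⟨κ, _, w, h3, h4⟩ := hy
      refine ⟨ι ⊕ κ, inferInstance, Sum.elim z w, ?_, ?_⟩
      · simpa [add_add_add_comm] using add_le_add h1 h3
      · convert add_le_add h2 h4 using 1
        · rw [star_add]; abel
        · simp
    | neg x _ hx =>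
      obtain ⟨ι, _, z, h1, h2⟩ := hx
      refine ⟨ι, inferInstance, z, ?_, ?_⟩
      · rwa [star_neg, ← neg_add]
      · rwa [star_neg, ← neg_add, neg_neg]
  obtain ⟨ι, _, z, hz, -⟩ := key 1 (one_mem_span_of_ne_zero hsimple hh)
  set s := ∑ i, z i * h * star (z i) with hs
  have h1s : 1 ≤ s := by
    refine le_trans ?_ hz
    rw [star_one]
    exact le_add_of_nonneg_right zero_le_one
  have hsp : IsStrictlyPositive s := IsStrictlyPositive.of_le (a := 1) (by simp) h1s
  have hr : star (s ^ (-(1 / 2) : ℝ)) = s ^ (-(1 / 2) : ℝ) :=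
    IsSelfAdjoint.of_nonneg CFC.rpow_nonneg
  refine ⟨ι, inferInstance, fun i => s ^ (-(1 / 2) : ℝ) * z i, ?_⟩
  calc ∑ i, s ^ (-(1 / 2) : ℝ) * z i * h * star (s ^ (-(1 / 2) : ℝ) * z i)
      = s ^ (-(1 / 2) : ℝ) * (∑ i, z i * h * star (z i)) * s ^ (-(1 / 2) : ℝ) := by
        simp only [star_mul, hr, Finset.mul_sum, Finset.sum_mul, mul_assoc]
    _ = 1 := CFC.conjugate_rpow_neg_one_half s hsp

theorem IsTracialState.map_nonneg [PartialOrder A] [StarOrderedRing A] {τ : A →L[ℂ] ℂ}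
    (hτ : IsTracialState τ) {a : A} (ha : 0 ≤ a) : 0 ≤ τ a := by
  obtain ⟨b, rfl⟩ := CStarAlgebra.nonneg_iff_eq_star_mul_self.1 ha
  exact hτ.1 b

/-- Tracial states on simple C*-algebras are faithful. -/
theorem IsTracialState.map_star_mul_self_eq_zero [Nontrivial A]
    (hsimple : ∀ I : TwoSidedIdeal A, IsClosed (I : Set A) → I = ⊥ ∨ I = ⊤) {τ : A →L[ℂ] ℂ}
    (hτ : IsTracialState τ) {a : A} (ha : τ (star a * a) = 0) : a = 0 := by
  let _ := CStarAlgebra.spectralOrder A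
  let _ := CStarAlgebra.spectralOrderedRing A
  by_contra hne
  obtain ⟨ι, _, z, hz⟩ := exists_sum_conjugate_eq_one hsimple (star_mul_self_nonneg a)
    (by simpa using hne)
  have key : ∀ i, τ (z i * (star a * a) * star (z i)) = 0 := by
    intro i
    have h1 : τ (z i * (star a * a) * star (z i)) = τ (a * (star (z i) * z i) * star a) := by
      rw [← mul_assoc (z i), mul_assoc (z i * star a), hτ.2.2 (z i * star a)]
      simp only [mul_assoc]
    refine le_antisymm ?_ (hτ.map_nonneg (star_right_conjugate_nonneg (star_mul_self_nonneg a) _))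
    rw [h1, ← sub_nonneg]
    have h2 := star_right_conjugate_le_conjugate
      (CStarAlgebra.star_mul_le_algebraMap_norm_sq (a := z i)) a
    have h3 := hτ.map_nonneg (sub_nonneg.2 h2)
    have h4 : a * algebraMap ℝ A (‖z i‖ ^ 2) * star a = ((‖z i‖ ^ 2 : ℝ) : ℂ) • (a * star a) := by
      rw [Algebra.algebraMap_eq_smul_one, Complex.coe_smul]
      simp
    rw [h4, map_sub, map_smul, hτ.2.2 a, ha, smul_zero] at h3
    exact h3
  have := hτ.2.1
  rw [← hz, map_sum] at this
  simp [key] at this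

theorem IsTracialState.sum_diag_mul_comm {τ : A →L[ℂ] ℂ} (hτ : IsTracialState τ)
    {m n : Type*} [Fintype m] [Fintype n] (x : Matrix m n A) (y : Matrix n m A) :
    ∑ i, τ ((x * y) i i) = ∑ j, τ ((y * x) j j) := by
  simp only [Matrix.mul_apply, map_sum]
  rw [Finset.sum_comm]
  exact Finset.sum_congr rfl fun _ _ => Finset.sum_congr rfl fun _ _ => hτ.2.2 _ _

theorem IsTracialState.sum_diag_conjTranspose_mul_self_nonneg {τ : A →L[ℂ] ℂ}
    (hτ : IsTracialState τ) {m n : Type*} [Fintype m] [Fintype n] (x : Matrix m n A) :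
    0 ≤ ∑ i, τ ((xᴴ * x) i i) := by
  simp only [Matrix.mul_apply, map_sum, Matrix.conjTranspose_apply]
  exact Finset.sum_nonneg fun _ _ => Finset.sum_nonneg fun _ _ => hτ.1 _

theorem IsTracialState.sum_diag_pos [Nontrivial A]
    (hsimple : ∀ I : TwoSidedIdeal A, IsClosed (I : Set A) → I = ⊥ ∨ I = ⊤) {τ : A →L[ℂ] ℂ}
    (hτ : IsTracialState τ) {k : ℕ} {q : Matrix (Fin k) (Fin k) A} (hq : q * q = q)
    (hqs : star q = q) (hne : q ≠ 0) : 0 < ∑ i, τ (q i i) := by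
  have hqq : qᴴ * q = q := by rw [← Matrix.star_eq_conjTranspose, hqs, hq]
  have h0 := hτ.sum_diag_conjTranspose_mul_self_nonneg q
  rw [hqq] at h0
  refine lt_of_le_of_ne h0 fun h => hne ?_
  rw [← hqq] at h
  simp only [Matrix.mul_apply, map_sum, Matrix.conjTranspose_apply] at h
  ext x y
  have h1 := (Finset.sum_eq_zero_iff_of_nonneg fun _ _ =>
    Finset.sum_nonneg fun _ _ => hτ.1 _).1 h.symm y (Finset.mem_univ _)
  have h2 := (Finset.sum_eq_zero_iff_of_nonneg fun _ _ => hτ.1 _).1 h1 x (Finset.mem_univ _)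
  exact hτ.map_star_mul_self_eq_zero hsimple h2

/-- Over a simple algebra, a nonzero projection `q` admits a finite family of columns in its range
that dominates the unit. -/
theorem exists_columns [Nontrivial A]
    (hsimple : ∀ I : TwoSidedIdeal A, IsClosed (I : Set A) → I = ⊥ ∨ I = ⊤) {τ : A →L[ℂ] ℂ}
    (hτ : IsTracialState τ) {k : ℕ} {q : Matrix (Fin k) (Fin k) A} (hq : q * q = q)
    (hqs : star q = q) (hne : q ≠ 0) :
    ∃ (ι : Type) (_ : Fintype ι) (c : ι → Matrix (Fin k) Unit A),
      (∀ i, q * c i = c i) ∧ ∑ i, (c i)ᴴ * c i = 1 := by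
  let _ := CStarAlgebra.spectralOrder A
  let _ := CStarAlgebra.spectralOrderedRing A
  have hqq : qᴴ * q = q := by rw [← Matrix.star_eq_conjTranspose, hqs, hq]
  obtain ⟨y, hy⟩ : ∃ y, q y y ≠ 0 := by
    by_contra! h
    simpa [h] using hτ.sum_diag_pos hsimple hq hqs hne
  have hyy : q y y = ∑ x, star (q x y) * q x y := by
    conv_lhs => rw [← hqq]
    simp [Matrix.mul_apply]
  obtain ⟨ι, _, z, hz⟩ := exists_sum_conjugate_eq_one hsimple
    (hyy ▸ Finset.sum_nonneg fun x _ => star_mul_self_nonneg (q x y)) hy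
  refine ⟨ι, inferInstance, fun i => Matrix.of fun x _ => q x y * star (z i), fun i => ?_, ?_⟩
  · ext x u
    have : q x y = ∑ j, q x j * q j y := by rw [← Matrix.mul_apply, hq]
    simp [this, Matrix.mul_apply, Finset.sum_mul, mul_assoc]
  · ext u v
    rw [Matrix.sum_apply, Subsingleton.elim u v, Matrix.one_apply_eq, ← hz]
    refine Finset.sum_congr rfl fun i _ => ?_
    rw [hyy]
    simp [Matrix.mul_apply, Finset.sum_mul, Finset.mul_sum, mul_assoc]

/-- The row matrices cut out of a projection `r` resolve `r`. -/
theorem sum_conjTranspose_row_mul_row {l : ℕ} {r : Matrix (Fin l) (Fin l) A} (hr : r * r = r)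
    (hrs : star r = r) :
    ∑ i, (Matrix.of fun (_ : Unit) y => r i y)ᴴ * (Matrix.of fun (_ : Unit) y => r i y) = r := by
  conv_rhs => rw [← hr]; lhs; rw [← hrs]
  ext x y
  simp [Matrix.sum_apply, Matrix.mul_apply, Matrix.star_apply]

theorem row_mul_mul_conjTranspose_row {l : ℕ} {r x : Matrix (Fin l) (Fin l) A}
    (hrs : star r = r) (h₁ : r * x = x) (h₂ : x * r = x) (i : Fin l) :
    (Matrix.of fun (_ : Unit) y => r i y) * x * (Matrix.of fun (_ : Unit) y => r i y)ᴴ =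
      Matrix.of fun _ _ => x i i := by
  have hstar : ∀ a b, star (r a b) = r b a := fun a b => by rw [← Matrix.star_apply, hrs]
  ext u v
  have : x i i = (r * x * r) i i := by rw [h₁, h₂]
  simp [this, Matrix.mul_apply, hstar]

/-- The linear map `x ↦ c x d*` into the corner of `q`, for `c`, `d` with range below `q`. -/
def compress {k : ℕ} {q : Matrix (Fin k) (Fin k) A} (hq : q * q = q) (hqs : star q = q)
    {m : Type*} [Fintype m] (c d : Matrix (Fin k) m A) (hc : q * c = c) (hd : q * d = d) :
    Matrix m m A →ₗ[ℂ] corner q hq hqs where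
  toFun x := ⟨c * x * dᴴ, by
    refine ⟨by simp only [← Matrix.mul_assoc, hc], ?_⟩
    have : dᴴ * q = dᴴ := by
      conv_rhs => rw [← hd, Matrix.conjTranspose_mul, ← Matrix.star_eq_conjTranspose q, hqs]
    rw [Matrix.mul_assoc, this]⟩
  map_add' x y := Subtype.ext (by simp [Matrix.mul_add, Matrix.add_mul])
  map_smul' a x := Subtype.ext (by simp)

@[simp]
theorem coe_compress {k : ℕ} {q : Matrix (Fin k) (Fin k) A} (hq : q * q = q) (hqs : star q = q)
    {m : Type*} [Fintype m] (c d : Matrix (Fin k) m A) (hc : q * c = c) (hd : q * d = d)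
    (x : Matrix m m A) :
    (compress hq hqs c d hc hd x : Matrix (Fin k) (Fin k) A) = c * x * dᴴ :=
  rfl

/-- If `A` has a unique tracial state, then a functional on `A` that is positive and tracial is a
multiple of it. -/
theorem exists_eq_mul_of_tracial {τ : A →L[ℂ] ℂ} (hτ : IsTracialState τ)
    (huniq : ∀ σ : A →L[ℂ] ℂ, IsTracialState σ → σ = τ) (σ : A →ₗ[ℂ] ℂ)
    (hpos : ∀ a, 0 ≤ σ (star a * a)) (hcomm : ∀ a b, σ (a * b) = σ (b * a)) :
    ∀ a, σ a = σ 1 * τ a := by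
  let _ := CStarAlgebra.spectralOrder A
  let _ := CStarAlgebra.spectralOrderedRing A
  have hσ : ∀ a, 0 ≤ a → 0 ≤ σ a := by
    intro a ha
    obtain ⟨b, rfl⟩ := CStarAlgebra.nonneg_iff_eq_star_mul_self.1 ha
    exact hpos b
  have hcont : Continuous σ := map_continuous (PositiveLinearMap.mk₀ σ hσ)
  let σ' : A →L[ℂ] ℂ := ⟨σ, hcont⟩
  have h1 : 0 ≤ σ 1 := hσ 1 zero_le_one
  have hp : 0 < 1 + σ 1 := add_pos_of_pos_of_nonneg one_pos h1
  have hs : (1 + σ 1)⁻¹ • (τ + σ') = τ := by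
    refine huniq _ ⟨fun a => ?_, ?_, fun a b => ?_⟩
    · exact mul_nonneg (inv_nonneg.2 hp.le) (add_nonneg (hτ.1 a) (hpos a))
    · change (1 + σ 1)⁻¹ * (τ 1 + σ 1) = 1
      rw [hτ.2.1, inv_mul_cancel₀ hp.ne']
    · change (1 + σ 1)⁻¹ * (τ (a * b) + σ (a * b)) = (1 + σ 1)⁻¹ * (τ (b * a) + σ (b * a))
      rw [hτ.2.2, hcomm]
  intro a
  have h2 : (1 + σ 1)⁻¹ * (τ a + σ a) = τ a := congrArg (fun f : A →L[ℂ] ℂ => f a) hs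
  rw [inv_mul_eq_iff_eq_mul₀ hp.ne'] at h2
  linear_combination h2

/-- Over a simple C*-algebra with a unique tracial state, a positive tracial functional on a corner
is a multiple of the canonical trace. -/
theorem exists_eq_mul_sum_diag [Nontrivial A]
    (hsimple : ∀ I : TwoSidedIdeal A, IsClosed (I : Set A) → I = ⊥ ∨ I = ⊤) {τ : A →L[ℂ] ℂ}
    (hτ : IsTracialState τ) (huniq : ∀ σ : A →L[ℂ] ℂ, IsTracialState σ → σ = τ)
    {k : ℕ} {q : Matrix (Fin k) (Fin k) A} (hq : q * q = q) (hqs : star q = q) (hne : q ≠ 0)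
    (F : corner q hq hqs →ₗ[ℂ] ℂ) (hpos : ∀ x, 0 ≤ F (x * star x))
    (hcomm : ∀ x y, F (x * y) = F (y * x)) :
    ∃ c : ℂ, ∀ x : corner q hq hqs, F x = c * ∑ i, τ ((x : Matrix (Fin k) (Fin k) A) i i) := by
  obtain ⟨ι, _, c, hc, hc1⟩ := exists_columns hsimple hτ hq hqs hne
  let S : A →ₗ[ℂ] Matrix Unit Unit A :=
    (Matrix.uniqueAlgEquiv (m := Unit) (R := ℂ) (A := A)).symm.toLinearMap
  have hS : ∀ a, S a = Matrix.of fun _ _ => a := fun a => rfl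
  have hSm : ∀ a b, S (a * b) = S a * S b := fun a b => by
    ext; simp [hS, Matrix.mul_apply]
  have hSs : ∀ a, S (star a) = (S a)ᴴ := fun a => by
    ext; simp [hS]
  let g : ι → ι → A →ₗ[ℂ] corner q hq hqs := fun i j =>
    compress hq hqs (c i) (c j) (hc i) (hc j) ∘ₗ S
  have hg : ∀ i j a, (g i j a : Matrix (Fin k) (Fin k) A) = c i * S a * (c j)ᴴ :=
    fun i j a => rfl
  have hgm : ∀ i j a b, g i j (a * b) = ∑ l, g i l a * g l j b := by
    intro i j a b
    apply Subtype.ext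
    have : c i * S (a * b) * (c j)ᴴ = c i * S a * (∑ l, (c l)ᴴ * c l) * S b * (c j)ᴴ := by
      rw [hc1, hSm, Matrix.mul_one, ← Matrix.mul_assoc]
    rw [hg, this]
    simp [hg, Matrix.mul_sum, Matrix.sum_mul, Matrix.mul_assoc]
  have hgs : ∀ i j a, star (g i j a) = g j i (star a) := by
    intro i j a
    apply Subtype.ext
    simp [hg, hSs, Matrix.star_eq_conjTranspose, Matrix.mul_assoc]
  let σ : A →ₗ[ℂ] ℂ := ∑ i, F ∘ₗ g i i
  have hσ : ∀ a, σ a = ∑ i, F (g i i a) := fun a => by simp [σ]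
  have hσm : ∀ a b, σ (a * b) = ∑ i, ∑ l, F (g i l a * g l i b) := fun a b => by
    simp [hσ, hgm]
  have hσc : ∀ a b, σ (a * b) = σ (b * a) := by
    intro a b
    rw [hσm, hσm, Finset.sum_comm]
    exact Finset.sum_congr rfl fun _ _ => Finset.sum_congr rfl fun _ _ => hcomm _ _
  have hσp : ∀ a, 0 ≤ σ (star a * a) := by
    intro a
    rw [hσc, hσm]
    refine Finset.sum_nonneg fun i _ => Finset.sum_nonneg fun l _ => ?_
    rw [← hgs]
    exact hpos _
  refine ⟨σ 1, fun x => ?_⟩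
  let row : Fin k → Matrix Unit (Fin k) A := fun i => Matrix.of fun _ y => q i y
  let d : ι → Fin k → corner q hq hqs := fun j i => ⟨c j * row i, by
    rw [← Matrix.mul_assoc, hc], by
    rw [Matrix.mul_assoc]
    congr 1
    ext u y
    conv_rhs => simp only [row, Matrix.of_apply]; rw [← hq]
    simp [row, Matrix.mul_apply]⟩
  have hx : x = ∑ i, ∑ j, x * star (d j i) * d j i := by
    apply Subtype.ext
    have h1 : ∀ i, ∑ j, (row i)ᴴ * (c j)ᴴ * (c j * row i) = (row i)ᴴ * row i := fun i => by
      calc ∑ j, (row i)ᴴ * (c j)ᴴ * (c j * row i)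
          = (row i)ᴴ * (∑ j, (c j)ᴴ * c j) * row i := by
            simp only [Matrix.mul_sum, Matrix.sum_mul, Matrix.mul_assoc]
        _ = (row i)ᴴ * row i := by rw [hc1, Matrix.mul_one]
    have h2 : ∑ i, (row i)ᴴ * row i = q := sum_conjTranspose_row_mul_row hq hqs
    simp only [AddSubmonoidClass.coe_finsetSum, NonUnitalStarSubalgebra.coe_mul]
    calc (x : Matrix (Fin k) (Fin k) A) = x * ∑ i, ∑ j, (row i)ᴴ * (c j)ᴴ * (c j * row i) := by
          simp only [h1, h2, x.2.2]
      _ = _ := by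
          simp [d, Matrix.mul_sum, Matrix.mul_assoc, Matrix.star_eq_conjTranspose]
  have hd : ∀ i j, d j i * (x * star (d j i)) = g j j ((x : Matrix (Fin k) (Fin k) A) i i) := by
    intro i j
    apply Subtype.ext
    rw [hg, hS, ← row_mul_mul_conjTranspose_row hqs x.2.1 x.2.2 i]
    simp [d, row, Matrix.mul_assoc, Matrix.star_eq_conjTranspose]
  have key := exists_eq_mul_of_tracial hτ huniq σ hσp hσc
  calc F x = ∑ i, ∑ j, F (g j j ((x : Matrix (Fin k) (Fin k) A) i i)) := by
        conv_lhs => rw [hx]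
        simp only [map_sum, hcomm (x * _), hd]
    _ = ∑ i, σ ((x : Matrix (Fin k) (Fin k) A) i i) := by simp only [hσ]
    _ = σ 1 * ∑ i, τ ((x : Matrix (Fin k) (Fin k) A) i i) := by
        rw [Finset.mul_sum]
        exact Finset.sum_congr rfl fun i _ => key _

/-- A *-isomorphism between corners scales the canonical trace. -/
theorem sum_diag_apply_starAlgEquiv [Nontrivial A]
    (hsimple : ∀ I : TwoSidedIdeal A, IsClosed (I : Set A) → I = ⊥ ∨ I = ⊤) {τ : A →L[ℂ] ℂ}
    (hτ : IsTracialState τ) (huniq : ∀ σ : A →L[ℂ] ℂ, IsTracialState σ → σ = τ)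
    {k n : ℕ} {q : Matrix (Fin k) (Fin k) A} {hq : q * q = q} {hqs : star q = q} (hne : q ≠ 0)
    {p : Matrix (Fin n) (Fin n) A} {hp : p * p = p} {hps : star p = p}
    (φ : corner q hq hqs ≃⋆ₐ[ℂ] corner p hp hps) (x : corner q hq hqs) :
    ∑ i, τ ((φ x : Matrix (Fin n) (Fin n) A) i i) =
      (∑ i, τ (p i i)) / (∑ i, τ (q i i)) *
        ∑ i, τ ((x : Matrix (Fin k) (Fin k) A) i i) := by
  let F : corner q hq hqs →ₗ[ℂ] ℂ :=
    { toFun := fun x => ∑ i, τ ((φ x : Matrix (Fin n) (Fin n) A) i i)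
      map_add' := fun x y => by simp [map_add, Finset.sum_add_distrib]
      map_smul' := fun a x => by simp [map_smul, Finset.mul_sum] }
  have hF : ∀ x, F x = ∑ i, τ ((φ x : Matrix (Fin n) (Fin n) A) i i) := fun _ => rfl
  have hcomm : ∀ x y, F (x * y) = F (y * x) := by
    intro x y
    simp only [hF, map_mul, NonUnitalStarSubalgebra.coe_mul]
    exact hτ.sum_diag_mul_comm _ _
  obtain ⟨c, hc⟩ := exists_eq_mul_sum_diag hsimple hτ huniq hq hqs hne F (fun x => by
    rw [hcomm]
    simp only [hF, map_mul, map_star, NonUnitalStarSubalgebra.coe_mul]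
    exact hτ.sum_diag_conjTranspose_mul_self_nonneg _) hcomm
  let q' : corner q hq hqs := ⟨q, hq, hq⟩
  let p' : corner p hp hps := ⟨p, hp, hp⟩
  have hqp : φ q' = p' := by
    have h1 : φ q' * p' = φ q' := Subtype.ext (φ q').2.2
    have h2 : q' * φ.symm p' = φ.symm p' := Subtype.ext (φ.symm p').2.1
    have h3 : φ q' * p' = p' := by
      have := congrArg φ h2
      rwa [map_mul, φ.apply_symm_apply] at this
    rw [← h1, h3]
  have h := hc q'
  rw [hF, hqp] at h
  rw [← hF, hc]
  congr 1
  rw [eq_div_iff (hτ.sum_diag_pos hsimple hq hqs hne).ne']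
  exact h.symm

/-- Over a simple algebra, every projection `r` is dominated by finitely many copies of a nonzero
projection `q`. -/
theorem exists_resolution [Nontrivial A]
    (hsimple : ∀ I : TwoSidedIdeal A, IsClosed (I : Set A) → I = ⊥ ∨ I = ⊤) {τ : A →L[ℂ] ℂ}
    (hτ : IsTracialState τ) {k l : ℕ} {q : Matrix (Fin k) (Fin k) A} (hq : q * q = q)
    (hqs : star q = q) (hne : q ≠ 0) {r : Matrix (Fin l) (Fin l) A} (hr : r * r = r)
    (hrs : star r = r) :
    ∃ (J : Type) (_ : Fintype J) (b : J → Matrix (Fin k) (Fin l) A),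
      (∀ j, q * b j = b j) ∧ (∀ j, b j * r = b j) ∧ ∑ j, (b j)ᴴ * b j = r := by
  obtain ⟨ι, _, c, hc, hc1⟩ := exists_columns hsimple hτ hq hqs hne
  let row : Fin l → Matrix Unit (Fin l) A := fun i => Matrix.of fun _ y => r i y
  refine ⟨Fin l × ι, inferInstance, fun j => c j.2 * row j.1, fun j => ?_, fun j => ?_, ?_⟩
  · rw [← Matrix.mul_assoc, hc]
  · rw [Matrix.mul_assoc]
    congr 1
    ext u y
    conv_rhs => simp only [row, Matrix.of_apply]; rw [← hr]
    simp [row, Matrix.mul_apply]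
  · have h1 : ∀ i, ∑ j, (row i)ᴴ * (c j)ᴴ * (c j * row i) = (row i)ᴴ * row i := fun i => by
      calc ∑ j, (row i)ᴴ * (c j)ᴴ * (c j * row i)
          = (row i)ᴴ * (∑ j, (c j)ᴴ * c j) * row i := by
            simp only [Matrix.mul_sum, Matrix.sum_mul, Matrix.mul_assoc]
        _ = (row i)ᴴ * row i := by rw [hc1, Matrix.mul_one]
    rw [Fintype.sum_prod_type]
    simp only [Matrix.conjTranspose_mul, h1]
    exact sum_conjTranspose_row_mul_row hr hrs

/-- A projection `r` can be transported along a *-isomorphism of corners `φ`: it is equivalent to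
a projection in matrices over the domain of `φ`, whose image under `φ` has a corner isomorphic to
that of `r`, and trace scaled by the ratio of the traces of the two units. -/
theorem exists_corner_equiv_of_starAlgEquiv [Nontrivial A]
    (hsimple : ∀ I : TwoSidedIdeal A, IsClosed (I : Set A) → I = ⊥ ∨ I = ⊤) {τ : A →L[ℂ] ℂ}
    (hτ : IsTracialState τ) (huniq : ∀ σ : A →L[ℂ] ℂ, IsTracialState σ → σ = τ)
    {k n l : ℕ} {q : Matrix (Fin k) (Fin k) A} {hq : q * q = q} {hqs : star q = q} (hne : q ≠ 0)
    {p : Matrix (Fin n) (Fin n) A} {hp : p * p = p} {hps : star p = p}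
    (φ : corner q hq hqs ≃⋆ₐ[ℂ] corner p hp hps)
    {r : Matrix (Fin l) (Fin l) A} (hr : r * r = r) (hrs : star r = r) :
    ∃ (m : ℕ) (e : Matrix (Fin m) (Fin m) A) (he : e * e = e) (hes : star e = e),
      Nonempty (corner e he hes ≃⋆ₐ[ℂ] corner r hr hrs) ∧
      ∑ i, τ (e i i) = (∑ i, τ (p i i)) / (∑ i, τ (q i i)) * ∑ i, τ (r i i) := by
  obtain ⟨J, _, b, hqb, hbr, hb⟩ := exists_resolution hsimple hτ hq hqs hne hr hrs
  have hrb : ∀ j, r * (b j)ᴴ = (b j)ᴴ := fun j => by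
    conv_rhs => rw [← hbr, Matrix.conjTranspose_mul, ← Matrix.star_eq_conjTranspose r, hrs]
  let g : J → J → Matrix (Fin l) (Fin l) A →ₗ[ℂ] corner q hq hqs := fun i j =>
    compress hq hqs (b i) (b j) (hqb i) (hqb j)
  have hg : ∀ i j x, (g i j x : Matrix (Fin k) (Fin k) A) = b i * x * (b j)ᴴ :=
    fun _ _ _ => rfl
  have hgm : ∀ i j x y, g i j (x * r * y) = ∑ s, g i s x * g s j y := by
    intro i j x y
    apply Subtype.ext
    rw [← hb]
    simp [hg, Matrix.mul_sum, Matrix.sum_mul, Matrix.mul_assoc]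
  have hgr : ∀ i j, g i j r = g i j 1 := fun i j => by
    apply Subtype.ext
    rw [hg, hg, hbr, Matrix.mul_one]
  have hgs : ∀ i j x, star (g i j x) = g j i (star x) := by
    intro i j x
    apply Subtype.ext
    simp [hg, Matrix.star_eq_conjTranspose, Matrix.mul_assoc]
  let m := Fintype.card (J × Fin n)
  let ε : Fin m ≃ J × Fin n := (Fintype.equivFin _).symm
  let B : J → J → Matrix (Fin m) (Fin m) A → Matrix (Fin n) (Fin n) A := fun i j y =>
    y.submatrix (fun a => ε.symm (i, a)) (fun a => ε.symm (j, a))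
  have hBext : ∀ {y z}, (∀ i j, B i j y = B i j z) → y = z := by
    intro y z h
    ext u v
    simpa [B] using congrFun (congrFun (h (ε u).1 (ε v).1) (ε u).2) (ε v).2
  have hBm : ∀ i j y z, B i j (y * z) = ∑ s, B i s y * B s j z := by
    intro i j y z
    ext u v
    simp only [B, Matrix.submatrix_apply, Matrix.mul_apply, Matrix.sum_apply]
    rw [← ε.symm.sum_comp, Fintype.sum_prod_type]
  have hBs : ∀ i j y, B i j (star y) = star (B j i y) := fun i j y => by
    ext u v
    simp [B, Matrix.star_apply]
  let Φ : Matrix (Fin l) (Fin l) A → Matrix (Fin m) (Fin m) A := fun x => Matrix.of fun u v =>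
    (φ (g (ε u).1 (ε v).1 x) : Matrix (Fin n) (Fin n) A) (ε u).2 (ε v).2
  have hBΦ : ∀ i j x, B i j (Φ x) = φ (g i j x) := fun i j x => by
    ext u v
    simp [B, Φ]
  have hΦm : ∀ x y, Φ x * Φ y = Φ (x * r * y) := fun x y => hBext fun i j => by
    rw [hBm, hBΦ, hgm]
    simp only [map_sum, map_mul, hBΦ, AddSubmonoidClass.coe_finsetSum,
      NonUnitalStarSubalgebra.coe_mul]
  have hΦs : ∀ x, star (Φ x) = Φ (star x) := fun x => hBext fun i j => by
    rw [hBs, hBΦ, hBΦ, ← hgs, map_star]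
    rfl
  have hΦr : Φ r = Φ 1 := hBext fun i j => by rw [hBΦ, hBΦ, hgr]
  have he : Φ 1 * Φ 1 = Φ 1 := by rw [hΦm, Matrix.one_mul, Matrix.mul_one, hΦr]
  have hes : star (Φ 1) = Φ 1 := by rw [hΦs, star_one]
  refine ⟨m, Φ 1, he, hes, ?_, ?_⟩
  · let Ψ : corner r hr hrs →⋆ₙₐ[ℂ] corner (Φ 1) he hes :=
      { toFun := fun x => ⟨Φ x, by rw [hΦm, Matrix.one_mul, x.2.1], by
          rw [hΦm, Matrix.mul_one, x.2.2]⟩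
        map_smul' := fun a x => Subtype.ext <| hBext fun i j => by
          have : B i j (a • Φ x) = a • B i j (Φ x) := rfl
          simp [this, hBΦ]
        map_zero' := Subtype.ext <| hBext fun i j => by
          have : B i j 0 = 0 := rfl
          simp [this, hBΦ]
        map_add' := fun x y => Subtype.ext <| hBext fun i j => by
          have : B i j (Φ x + Φ y) = B i j (Φ x) + B i j (Φ y) := rfl
          simp [this, hBΦ]
        map_mul' := fun x y => Subtype.ext <| by
          simp [hΦm, x.2.2]
        map_star' := fun x => Subtype.ext (hΦs x).symm }
    have hΨ : ∀ x, (Ψ x : Matrix (Fin m) (Fin m) A) = Φ x := fun _ => rfl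
    refine ⟨(StarAlgEquiv.ofBijective Ψ ⟨fun x y hxy => ?_, fun y => ?_⟩).symm⟩
    · have hgxy : ∀ i j, g i j x = g i j y := fun i j => φ.injective <| Subtype.ext <| by
        change (φ (g i j x) : Matrix (Fin n) (Fin n) A) = φ (g i j y)
        rw [← hBΦ, ← hBΦ, ← hΨ, ← hΨ, hxy]
      have hrec : ∀ z : corner r hr hrs, (z : Matrix (Fin l) (Fin l) A) =
          ∑ i, ∑ j, (b i)ᴴ * (g i j z : Matrix (Fin k) (Fin k) A) * b j := fun z => by
        calc (z : Matrix (Fin l) (Fin l) A)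
            = (∑ i, (b i)ᴴ * b i) * z * ∑ j, (b j)ᴴ * b j := by rw [hb, z.2.1, z.2.2]
          _ = _ := by
              simp only [hg, Matrix.sum_mul, Matrix.mul_sum, Matrix.mul_assoc]
              exact Finset.sum_comm
      apply Subtype.ext
      rw [hrec x, hrec y]
      simp only [hgxy]
    · have hl : ∀ i j, p * B i j y = B i j y := fun i j => by
        conv_rhs => rw [← y.2.1]
        conv_lhs => rw [← y.2.1]
        rw [hBm, Matrix.mul_sum]
        refine Finset.sum_congr rfl fun s _ => ?_
        rw [← Matrix.mul_assoc, hBΦ, (φ _).2.1]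
      have hrt : ∀ i j, B i j y * p = B i j y := fun i j => by
        conv_rhs => rw [← y.2.2]
        conv_lhs => rw [← y.2.2]
        rw [hBm, Matrix.sum_mul]
        refine Finset.sum_congr rfl fun s _ => ?_
        rw [Matrix.mul_assoc, hBΦ, (φ _).2.2]
      let Y : J → J → corner p hp hps := fun i j => ⟨B i j y, hl i j, hrt i j⟩
      let x : Matrix (Fin l) (Fin l) A :=
        ∑ i, ∑ j, (b i)ᴴ * (φ.symm (Y i j) : Matrix (Fin k) (Fin k) A) * b j
      have hx1 : r * x = x := by
        simp only [x, Matrix.mul_sum, ← Matrix.mul_assoc, hrb]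
      have hx2 : x * r = x := by
        simp only [x, Matrix.sum_mul, Matrix.mul_assoc, hbr]
      refine ⟨⟨x, hx1, hx2⟩, Subtype.ext (hBext fun s t => ?_)⟩
      have hgx : g s t x = ∑ i, ∑ j, g s i 1 * φ.symm (Y i j) * g j t 1 := by
        apply Subtype.ext
        simp [hg, x, Matrix.mul_assoc]
      rw [hΨ, hBΦ, hgx]
      have hy : (y : Matrix (Fin m) (Fin m) A) = Φ 1 * y * Φ 1 := by rw [y.2.1, y.2.2]
      conv_rhs => rw [hy]
      simp only [map_sum, map_mul, StarAlgEquiv.apply_symm_apply, hBm, hBΦ,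
        AddSubmonoidClass.coe_finsetSum, NonUnitalStarSubalgebra.coe_mul, Finset.sum_mul]
      exact Finset.sum_comm
  · have hBt : ∑ u, τ (Φ 1 u u) = ∑ j, ∑ a, τ (B j j (Φ 1) a a) := by
      rw [← ε.symm.sum_comp, Fintype.sum_prod_type]
      rfl
    rw [hBt]
    simp only [hBΦ, sum_diag_apply_starAlgEquiv hsimple hτ huniq hne φ]
    rw [← Finset.mul_sum]
    congr 1
    simp only [hg, Matrix.mul_one, hτ.sum_diag_mul_comm (b _)]
    rw [Finset.sum_comm, ← hb]
    simp [Matrix.sum_apply]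

end Corners

/-- Let `A` be a simple unital C*-algebra with a unique tracial state `τ` and let `p` be a
nonzero projection in `M_n(A)`. Then `𝓕_p(A)` is a subgroup of the multiplicative group of
positive reals: every element is strictly positive, `1 ∈ 𝓕_p(A)`, and `𝓕_p(A)` is closed
under multiplication and inverses. -/
theorem relFundGroup_isSubgroup {A : Type*} [CStarAlgebra A] [Nontrivial A]
    (hsimple : ∀ I : TwoSidedIdeal A, IsClosed (I : Set A) → I = ⊥ ∨ I = ⊤)
    (τ : A →L[ℂ] ℂ) (hτ : IsTracialState τ)
    (huniq : ∀ σ : A →L[ℂ] ℂ, IsTracialState σ → σ = τ)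
    {n : ℕ} (p : Matrix (Fin n) (Fin n) A) (hp : p * p = p) (hps : star p = p) (hpne : p ≠ 0) :
    (∀ t ∈ relFundGroup τ p hp hps, 0 < t) ∧ (1 : ℝ) ∈ relFundGroup τ p hp hps ∧
    (∀ s t : ℝ, s ∈ relFundGroup τ p hp hps → t ∈ relFundGroup τ p hp hps →
      s * t ∈ relFundGroup τ p hp hps) ∧
    (∀ t ∈ relFundGroup τ p hp hps, t⁻¹ ∈ relFundGroup τ p hp hps) := by
  have hpp := hτ.sum_diag_pos hsimple hp hps hpne
  have him : ∀ {z : ℂ}, 0 < z → z = (z.re : ℂ) ∧ 0 < z.re := fun hz =>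
    ⟨Complex.ext rfl (by simpa using (Complex.pos_iff.1 hz).2.symm), (Complex.pos_iff.1 hz).1⟩
  obtain ⟨hPre, hPpos⟩ := him hpp
  have hne_of : ∀ {m : ℕ} {e : Matrix (Fin m) (Fin m) A}, ∑ i, τ (e i i) ≠ 0 → e ≠ 0 := by
    rintro m _ h rfl
    simp at h
  refine ⟨?_, ⟨n, p, hp, hps, hpne, ⟨StarAlgEquiv.refl ..⟩, (div_self hPpos.ne').symm⟩, ?_, ?_⟩
  · rintro t ⟨k, q, hq, hqs, hqne, -, rfl⟩
    exact div_pos (him (hτ.sum_diag_pos hsimple hq hqs hqne)).2 hPpos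
  · rintro s t ⟨k, q, hq, hqs, hqne, ⟨φ⟩, rfl⟩ ⟨l, r, hr, hrs, hrne, ⟨ψ⟩, rfl⟩
    obtain ⟨hQre, hQpos⟩ := him (hτ.sum_diag_pos hsimple hq hqs hqne)
    obtain ⟨hRre, hRpos⟩ := him (hτ.sum_diag_pos hsimple hr hrs hrne)
    obtain ⟨m, e, he, hes, ⟨χ⟩, hte⟩ :=
      exists_corner_equiv_of_starAlgEquiv hsimple hτ huniq hpne φ.symm hr hrs
    rw [hPre, hQre, hRre, ← Complex.ofReal_div, ← Complex.ofReal_mul] at hte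
    refine ⟨m, e, he, hes, hne_of ?_, ⟨χ.trans ψ⟩, ?_⟩
    · rw [hte]
      exact Complex.ofReal_ne_zero.2 (by positivity)
    · rw [hte, Complex.ofReal_re]
      field_simp
  · rintro t ⟨k, q, hq, hqs, hqne, ⟨φ⟩, rfl⟩
    obtain ⟨hQre, hQpos⟩ := him (hτ.sum_diag_pos hsimple hq hqs hqne)
    obtain ⟨m, e, he, hes, ⟨χ⟩, hte⟩ :=
      exists_corner_equiv_of_starAlgEquiv hsimple hτ huniq hqne φ hp hps
    rw [hPre, hQre, ← Complex.ofReal_div, ← Complex.ofReal_mul] at hte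
    refine ⟨m, e, he, hes, hne_of ?_, ⟨χ⟩, ?_⟩
    · rw [hte]
      exact Complex.ofReal_ne_zero.2 (by positivity)
    · rw [hte, Complex.ofReal_re]
      field_simp
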